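/- Zero duality gap at a KKT point for the group-feature-selection multiple-kernel problem (Proposition 1, optimality direction): let w_1,…,w_T ∈ ℝ^m and ξ ≥ 0 satisfy the primal constraints ξ ≥ b_{ȳ'} − Σ_{t=1}^T ⟨w_t, a^t_{ȳ'}⟩ for every ȳ' ∈ Ȳ∖{ȳ}; let α : Ȳ∖{ȳ} → ℝ with α_{ȳ'} ≥ 0 and Σ_{ȳ'} α_{ȳ'} ≤ C, and let μ_1,…,μ_T ≥ 0 with Σ_{t=1}^T μ_t = 1. Set u_t = Σ_{ȳ'∈Ȳ∖{ȳ}} α_{ȳ'}·a^t_{ȳ'}. Assume (i) w_t = μ_t·u_t for every t, (ii) for every ȳ' with α_{ȳ'} > 0 one has ξ = b_{ȳ'} − Σ_{t=1}^T ⟨w_t, a^t_{ȳ'}⟩, (iii) for every t with μ_t > 0 one has ‖u_t‖₂² = max_{1≤s≤T} ‖u_s‖₂², and (iv) ξ·(C − Σ_{ȳ'} α_{ȳ'}) = 0. Then (1/2)·(Σ_{t=1}^T ‖w_t‖₂)² + C·ξ = Σ_{ȳ'} α_{ȳ'}·b_{ȳ'} − (1/2)·max_{1≤t≤T} ‖u_t‖₂²,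 and consequently (w_1,…,w_T, ξ) minimizes the primal objective (1/2)·(Σ_t ‖w_t‖₂)² + C·ξ over all primal-feasible points. -/

import Mathlib

open Finset

noncomputable section

/-- Euclidean inner product on `Fin m → ℝ`. -/
def inn {m : ℕ} (u v : Fin m → ℝ) : ℝ := ∑ j, u j * v j

/-- Euclidean norm on `Fin m → ℝ`. -/
def euclNorm {m : ℕ} (v : Fin m → ℝ) : ℝ := Real.sqrt (∑ j, (v j) ^ 2)

/-- The vector `a^t_{ȳ'} = (1/n) ∑ᵢ (yᵢ - y'ᵢ) (xᵢ ⊙ d)`. -/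
def avec {n m : ℕ} (x : Fin n → Fin m → ℝ) (y : Fin n → ℝ) (d : Fin m → ℝ)
    (y' : Fin n → ℝ) : Fin m → ℝ :=
  fun j => (1 / (n : ℝ)) * ∑ i, (y i - y' i) * (x i j * d j)

theorem euclNorm_nonneg {m : ℕ} (v : Fin m → ℝ) : 0 ≤ euclNorm v := Real.sqrt_nonneg _

theorem euclNorm_sq {m : ℕ} (v : Fin m → ℝ) : euclNorm v ^ 2 = inn v v := by
  rw [euclNorm, Real.sq_sqrt (Finset.sum_nonneg fun j _ => sq_nonneg _), inn]
  exact Finset.sum_congr rfl fun j _ => pow_two _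

theorem inn_smul_left {m : ℕ} (c : ℝ) (u v : Fin m → ℝ) :
    inn (fun j => c * u j) v = c * inn u v := by
  simp only [inn, Finset.mul_sum, mul_assoc]

theorem euclNorm_smul {m : ℕ} {c : ℝ} (hc : 0 ≤ c) (v : Fin m → ℝ) :
    euclNorm (fun j => c * v j) = c * euclNorm v := by
  simp only [euclNorm, mul_pow, ← Finset.mul_sum]
  rw [Real.sqrt_mul (sq_nonneg c), Real.sqrt_sq hc]

theorem inn_le_euclNorm_mul {m : ℕ} (u v : Fin m → ℝ) :
    inn u v ≤ euclNorm u * euclNorm v :=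
  Real.sum_mul_le_sqrt_mul_sqrt _ _ _

theorem inn_sum_smul_right {m : ℕ} {ι : Type*} (s : Finset ι) (α : ι → ℝ)
    (v : Fin m → ℝ) (a : ι → Fin m → ℝ) (u : Fin m → ℝ)
    (hu : ∀ j, u j = ∑ i ∈ s, α i * a i j) :
    inn v u = ∑ i ∈ s, α i * inn v (a i) := by
  simp only [inn, hu, Finset.mul_sum]
  rw [Finset.sum_comm]
  exact Finset.sum_congr rfl fun i _ => Finset.sum_congr rfl fun j _ => by ring

/-- Zero duality gap at a KKT point for the group-feature-selection multiple-kernel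
problem (Proposition 1, optimality direction). -/
theorem zero_gap_group_mkl
    (n m T : ℕ) (hn : 0 < n) (hm : 0 < m) (hT : 0 < T)
    (C : ℝ) (hC : 0 < C)
    (x : Fin n → Fin m → ℝ)
    (y : Fin n → ℝ) (hy : ∀ i, y i = 1 ∨ y i = -1)
    (Y : Finset (Fin n → ℝ)) (hyY : y ∈ Y)
    (hYpm : ∀ y' ∈ Y, ∀ i, y' i = 1 ∨ y' i = -1)
    (hYne : (Y.erase y).Nonempty)
    (Δ : (Fin n → ℝ) → (Fin n → ℝ) → ℝ)
    (d : Fin T → Fin m → ℝ) (hd : ∀ t j, d t j = 0 ∨ d t j = 1)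
    (w : Fin T → Fin m → ℝ) (ξ : ℝ) (hξ : 0 ≤ ξ)
    (hfeas : ∀ y' ∈ Y.erase y,
      ξ ≥ Δ y y' / n - ∑ t, inn (w t) (avec x y (d t) y'))
    (α : (Fin n → ℝ) → ℝ)
    (hα : ∀ y' ∈ Y.erase y, 0 ≤ α y')
    (hαsum : ∑ y' ∈ Y.erase y, α y' ≤ C)
    (μ : Fin T → ℝ) (hμ : ∀ t, 0 ≤ μ t) (hμsum : ∑ t, μ t = 1)
    (u : Fin T → Fin m → ℝ)
    (hu : ∀ t j, u t j = ∑ y' ∈ Y.erase y, α y' * avec x y (d t) y' j)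
    (hKKT1 : ∀ t, w t = fun j => μ t * u t j)
    (hKKT2 : ∀ y' ∈ Y.erase y, 0 < α y' →
      ξ = Δ y y' / n - ∑ t, inn (w t) (avec x y (d t) y'))
    (hKKT3 : ∀ t, 0 < μ t →
      euclNorm (u t) ^ 2 =
        Finset.univ.sup' (Finset.univ_nonempty_iff.mpr ⟨⟨0, hT⟩⟩)
          (fun s => euclNorm (u s) ^ 2))
    (hKKT4 : ξ * (C - ∑ y' ∈ Y.erase y, α y') = 0) :
    ((1 / 2) * (∑ t, euclNorm (w t)) ^ 2 + C * ξ =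
      (∑ y' ∈ Y.erase y, α y' * (Δ y y' / n)) -
      (1 / 2) * (Finset.univ.sup' (Finset.univ_nonempty_iff.mpr ⟨⟨0, hT⟩⟩)
        (fun t => euclNorm (u t) ^ 2))) ∧
    (∀ (w' : Fin T → Fin m → ℝ) (ξ' : ℝ), 0 ≤ ξ' →
      (∀ y' ∈ Y.erase y,
        ξ' ≥ Δ y y' / n - ∑ t, inn (w' t) (avec x y (d t) y')) →
      (1 / 2) * (∑ t, euclNorm (w t)) ^ 2 + C * ξ ≤
        (1 / 2) * (∑ t, euclNorm (w' t)) ^ 2 + C * ξ') := by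
  have hnon : (Finset.univ : Finset (Fin T)).Nonempty :=
    Finset.univ_nonempty_iff.mpr ⟨⟨0, hT⟩⟩
  set M : ℝ := Finset.univ.sup' hnon (fun t => euclNorm (u t) ^ 2)
  have hle : ∀ t, euclNorm (u t) ^ 2 ≤ M := fun t =>
    Finset.le_sup' (fun t => euclNorm (u t) ^ 2) (Finset.mem_univ t)
  have hM0 : 0 ≤ M := (sq_nonneg _).trans (hle ⟨0, hT⟩)
  have hR : √M ^ 2 = M := Real.sq_sqrt hM0
  have hnorm : ∀ t, euclNorm (u t) ≤ √M := fun t => Real.le_sqrt_of_sq_le (hle t)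
  have hnormw : ∑ t, euclNorm (w t) = √M := by
    rw [← one_mul √M, ← hμsum, Finset.sum_mul]
    refine Finset.sum_congr rfl fun t _ => ?_
    rw [hKKT1 t, euclNorm_smul (hμ t)]
    rcases (hμ t).eq_or_lt with h | h
    · simp [← h]
    · rw [← hKKT3 t h, Real.sqrt_sq (euclNorm_nonneg _)]
  have hinner : ∑ t, inn (w t) (u t) = M := by
    rw [← one_mul M, ← hμsum, Finset.sum_mul]
    refine Finset.sum_congr rfl fun t _ => ?_
    rw [hKKT1 t, inn_smul_left, ← euclNorm_sq]
    rcases (hμ t).eq_or_lt with h | h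
    · simp [← h]
    · rw [hKKT3 t h]
  have hswap : ∀ v : Fin T → Fin m → ℝ,
      ∑ y' ∈ Y.erase y, α y' * (Δ y y' / n - ∑ t, inn (v t) (avec x y (d t) y')) =
        (∑ y' ∈ Y.erase y, α y' * (Δ y y' / n)) - ∑ t, inn (v t) (u t) := by
    intro v
    simp only [mul_sub, Finset.sum_sub_distrib]
    congr 1
    simp only [Finset.mul_sum]
    rw [Finset.sum_comm]
    exact Finset.sum_congr rfl fun t _ =>
      (inn_sum_smul_right _ α (v t) (avec x y (d t)) (u t) (hu t)).symm
  have hslack : (∑ y' ∈ Y.erase y, α y') * ξ =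
      (∑ y' ∈ Y.erase y, α y' * (Δ y y' / n)) - M := by
    rw [← hinner, ← hswap w, Finset.sum_mul]
    refine Finset.sum_congr rfl fun y' hy' => ?_
    rcases (hα y' hy').eq_or_lt with h | h
    · simp [← h]
    · rw [← hKKT2 y' hy' h]
  have hgap : (1 / 2) * (∑ t, euclNorm (w t)) ^ 2 + C * ξ =
      (∑ y' ∈ Y.erase y, α y' * (Δ y y' / n)) - (1 / 2) * M := by
    rw [hnormw, hR]
    linarith
  refine ⟨hgap, fun w' ξ' hξ' hfeas' => ?_⟩
  rw [hgap]
  have hdual : (∑ y' ∈ Y.erase y, α y' * (Δ y y' / n)) - ∑ t, inn (w' t) (u t) ≤ C * ξ' := by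
    rw [← hswap w']
    refine le_trans ?_ (mul_le_mul_of_nonneg_right hαsum hξ')
    rw [Finset.sum_mul]
    exact Finset.sum_le_sum fun y' hy' =>
      mul_le_mul_of_nonneg_left (hfeas' y' hy') (hα y' hy')
  have hcs : ∑ t, inn (w' t) (u t) ≤ (∑ t, euclNorm (w' t)) * √M := by
    rw [Finset.sum_mul]
    exact Finset.sum_le_sum fun t _ => (inn_le_euclNorm_mul _ _).trans
      (mul_le_mul_of_nonneg_left (hnorm t) (euclNorm_nonneg _))
  linarith [two_mul_le_add_sq (∑ t, euclNorm (w' t)) √M]
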